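/- For all integers n ≥ 0 and k ≥ 1, one has (−1)^{k−1} ( Σ_{j=0}^{2k−1} (−1)^{T_j} Q(n − 2G_j) − χ(n) ) = Σ_{j ≥ 0, T_j ≤ n, n ≡ T_j (mod 2)} M_k((n − T_j)/2), where χ(n) = 1 if n is a triangular number (n = T_m for some integer m ≥ 0) and χ(n) = 0 otherwise. -/

import Mathlib

/-- The `n`-th triangular number `T n = n(n+1)/2`. -/
def T (n : ℕ) : ℕ := n * (n + 1) / 2

/-- The `n`-th generalized pentagonal number `G n = T n - T ⌊n/2⌋`. -/
def G (n : ℕ) : ℕ := T n - T (n / 2)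

/-- The number of partitions of `n` into distinct parts, vanishing on negative integers. -/
def Q (n : ℤ) : ℤ :=
  if 0 ≤ n then ((Nat.Partition.distincts n.toNat).card : ℤ) else 0

open Classical in
/-- `χ(n) = 1` if `n` is a triangular number, `0` otherwise. -/
noncomputable def chi (n : ℕ) : ℤ := if ∃ m, n = T m then 1 else 0

/-- `M k n` is the number of partitions of `n` in which `k` is the least positive integer
that is not a part, and the number of parts greater than `k` exceeds the number of parts
less than `k` (parts counted with multiplicity). -/
noncomputable def M (k n : ℕ) : ℕ :=
  Nat.card {p : Nat.Partition n //
    (∀ i, 0 < i → i < k → i ∈ p.parts) ∧ k ∉ p.parts ∧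
      (p.parts.filter fun x => x < k).card < (p.parts.filter fun x => k < x).card}


open PowerSeries

/-- The generating function, by size, of the partitions whose multiset of parts satisfies `S`. -/
noncomputable def partGF (S : Multiset ℕ → Prop) : PowerSeries ℤ :=
  PowerSeries.mk fun n => (Nat.card {p : Nat.Partition n // S p.parts} : ℤ)

lemma coeff_partGF (S : Multiset ℕ → Prop) (n : ℕ) :
    coeff n (partGF S) = (Nat.card {p : Nat.Partition n // S p.parts} : ℤ) := by
  simp [partGF]

lemma Nat.Partition.zero_notMem_parts {n : ℕ} (p : Nat.Partition n) : 0 ∉ p.parts :=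
  fun h => (p.parts_pos h).ne' rfl

lemma partGF_congr {S S' : Multiset ℕ → Prop} (h : ∀ s, 0 ∉ s → (S s ↔ S' s)) :
    partGF S = partGF S' := by
  ext n
  rw [coeff_partGF, coeff_partGF]
  congr 1
  exact Nat.card_congr (Equiv.subtypeEquivRight fun p => h _ p.zero_notMem_parts)

lemma partGF_split (S P : Multiset ℕ → Prop) :
    partGF S = partGF (fun s => S s ∧ P s) + partGF (fun s => S s ∧ ¬ P s) := by
  classical
  ext n
  rw [map_add, coeff_partGF, coeff_partGF, coeff_partGF]
  simp only [Nat.card_eq_fintype_card, Fintype.card_subtype]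
  rw [← Finset.card_filter_add_card_filter_not (fun p : Nat.Partition n => P p.parts),
    Finset.filter_filter, Finset.filter_filter]
  push_cast
  rfl

/-- A bijection between two classes of partitions that raises the size by `c` multiplies the
generating function by `X ^ c`. -/
lemma partGF_eq_X_pow_mul {S S' : Multiset ℕ → Prop} (c : ℕ) (f g : Multiset ℕ → Multiset ℕ)
    (hf : ∀ s, 0 ∉ s → S s → 0 ∉ f s ∧ S' (f s) ∧ (f s).sum = s.sum + c ∧ g (f s) = s)
    (hg : ∀ s, 0 ∉ s → S' s → 0 ∉ g s ∧ S (g s) ∧ s.sum = (g s).sum + c ∧ f (g s) = s) :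
    partGF S' = X ^ c * partGF S := by
  ext n
  rw [coeff_X_pow_mul', coeff_partGF]
  split_ifs with h
  · rw [coeff_partGF]
    congr 1
    refine Nat.card_congr
      { toFun := fun p => ⟨⟨g p.1.parts, fun {i} hi => ?_, ?_⟩, ?_⟩
        invFun := fun p => ⟨⟨f p.1.parts, fun {i} hi => ?_, ?_⟩, ?_⟩
        left_inv := fun p => ?_
        right_inv := fun p => ?_ }
    · exact Nat.pos_of_ne_zero fun h0 => (hg _ p.1.zero_notMem_parts p.2).1 (h0 ▸ hi)
    · have h1 := (hg _ p.1.zero_notMem_parts p.2).2.2.1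
      rw [p.1.parts_sum] at h1
      omega
    · exact (hg _ p.1.zero_notMem_parts p.2).2.1
    · exact Nat.pos_of_ne_zero fun h0 => (hf _ p.1.zero_notMem_parts p.2).1 (h0 ▸ hi)
    · have h1 := (hf _ p.1.zero_notMem_parts p.2).2.2.1
      rw [p.1.parts_sum] at h1
      omega
    · exact (hf _ p.1.zero_notMem_parts p.2).2.1
    · exact Subtype.ext (Nat.Partition.ext (hg _ p.1.zero_notMem_parts p.2).2.2.2)
    · exact Subtype.ext (Nat.Partition.ext (hf _ p.1.zero_notMem_parts p.2).2.2.2)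
  · have : IsEmpty {p : Nat.Partition n // S' p.parts} := ⟨fun p => by
      have h1 := (hg _ p.1.zero_notMem_parts p.2).2.2.1
      rw [p.1.parts_sum] at h1
      omega⟩
    simp

/-- Removing one copy of the part `c`. -/
lemma partGF_notMem (S : Multiset ℕ → Prop) {c : ℕ} (hc : 0 < c) :
    partGF (fun s => S s ∧ c ∉ s) = partGF S - X ^ c * partGF (fun s => S (c ::ₘ s)) := by
  rw [partGF_split S (fun s => c ∈ s)]
  rw [partGF_eq_X_pow_mul (S := fun s => S (c ::ₘ s)) (S' := fun s => S s ∧ c ∈ s) c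
    (fun s => c ::ₘ s) (fun s => s.erase c)]
  · ring
  · intro s h0 hs
    refine ⟨?_, ⟨hs, Multiset.mem_cons_self _ _⟩, ?_, Multiset.erase_cons_head _ _⟩
    · simp [h0, hc.ne]
    · simp [add_comm]
  · rintro s h0 ⟨hs, hcs⟩
    refine ⟨fun h => h0 (Multiset.mem_of_mem_erase h), ?_, ?_, Multiset.cons_erase hcs⟩
    · rwa [Multiset.cons_erase hcs]
    · rw [← Multiset.sum_erase hcs, add_comm]

/-- The number of parts greater than `k` minus the number of parts at most `k`. -/
def excess (k : ℕ) (s : Multiset ℕ) : ℤ := (s.map fun c => if k < c then (1 : ℤ) else -1).sum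

lemma excess_cons (k c : ℕ) (s : Multiset ℕ) :
    excess k (c ::ₘ s) = (if k < c then 1 else -1) + excess k s := by
  simp [excess]

lemma excess_add (k : ℕ) (s t : Multiset ℕ) : excess k (s + t) = excess k s + excess k t := by
  simp [excess]

lemma excess_le_card (k : ℕ) (s : Multiset ℕ) : excess k s ≤ s.card := by
  induction s using Multiset.induction with
  | empty => simp [excess]
  | cons a s ih =>
    rw [excess_cons, Multiset.card_cons]
    push_cast
    split_ifs <;> omega

lemma excess_eq_card_sub_card (k : ℕ) (s : Multiset ℕ) :
    excess k s = (s.filter fun x => k < x).card - ((s.filter fun x => x ≤ k).card : ℤ) := by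
  induction s using Multiset.induction with
  | empty => simp [excess]
  | cons a s ih =>
    rw [excess_cons, ih]
    by_cases h : k < a
    · simp [h, h.not_ge]; ring
    · simp [h, not_lt.mp h]; ring

lemma excess_zero {s : Multiset ℕ} (hs : 0 ∉ s) : excess 0 s = s.card := by
  have h : ∀ x ∈ s, 0 < x := fun x hx => Nat.pos_of_ne_zero fun h => hs (h ▸ hx)
  have h' : ∀ x ∈ s, ¬ x ≤ 0 := fun x hx => (h x hx).not_ge
  rw [excess_eq_card_sub_card, Multiset.filter_eq_self.mpr h, Multiset.filter_eq_nil.mpr h']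
  simp

lemma excess_succ {k : ℕ} {s : Multiset ℕ} (hs : k + 1 ∉ s) : excess (k + 1) s = excess k s := by
  unfold excess
  congr 1
  refine Multiset.map_congr rfl fun x hx => ?_
  have : x ≠ k + 1 := fun h => hs (h ▸ hx)
  split_ifs <;> first | rfl | omega

lemma Nat.Partition.card_parts_le {n : ℕ} (p : Nat.Partition n) : p.parts.card ≤ n := by
  conv_rhs => rw [← p.parts_sum]
  have := Multiset.card_nsmul_le_sum (s := p.parts) (a := 1) (fun x hx => p.parts_pos hx)
  simpa using this

/-- The generating function of partitions with excess at least `j`. -/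
noncomputable def tailGF (k : ℕ) (j : ℤ) : PowerSeries ℤ := partGF fun s => j ≤ excess k s

lemma coeff_tailGF_eq_zero (k : ℕ) {j : ℤ} {n : ℕ} (h : (n : ℤ) < j) :
    coeff n (tailGF k j) = 0 := by
  rw [tailGF, coeff_partGF]
  have : IsEmpty {p : Nat.Partition n // j ≤ excess k p.parts} := ⟨fun p => by
    have h1 := excess_le_card k p.1.parts
    have h2 := p.1.card_parts_le
    have h3 := p.2
    omega⟩
  simp

lemma partGF_excess_eq (k : ℕ) (j : ℤ) :
    partGF (fun s => excess k s = j) = tailGF k j - tailGF k (j + 1) := by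
  have h := partGF_split (fun s => j ≤ excess k s) (fun s => excess k s = j)
  rw [partGF_congr (S := fun s => j ≤ excess k s ∧ excess k s = j) (S' := fun s => excess k s = j)
      (fun s _ => by omega),
    partGF_congr (S := fun s => j ≤ excess k s ∧ ¬ excess k s = j)
      (S' := fun s => j + 1 ≤ excess k s) (fun s _ => by omega)] at h
  rw [tailGF, tailGF, h]
  ring

lemma partGF_excess_notMem {k : ℕ} (hk : 0 < k) (j : ℤ) :
    partGF (fun s => j ≤ excess k s ∧ k ∉ s) = tailGF k j - X ^ k * tailGF k (j + 1) := by
  rw [partGF_notMem _ hk, tailGF, tailGF]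
  congr 2
  exact partGF_congr fun s _ => by simp only [excess_cons, lt_irrefl, if_false]; omega

lemma partGF_excess_notMem_succ (k : ℕ) (j : ℤ) :
    partGF (fun s => j ≤ excess k s ∧ k + 1 ∉ s) =
      tailGF k j - X ^ (k + 1) * tailGF k (j - 1) := by
  rw [partGF_notMem (c := k + 1) _ k.succ_pos, tailGF, tailGF]
  congr 2
  exact partGF_congr fun s _ => by simp only [excess_cons, lt_add_one, if_true]; omega

lemma tailGF_succ (k : ℕ) (j : ℤ) :
    tailGF k j - X ^ (k + 1) * tailGF k (j - 1) =
      tailGF (k + 1) j - X ^ (k + 1) * tailGF (k + 1) (j + 1) := by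
  rw [← partGF_excess_notMem_succ, ← partGF_excess_notMem k.succ_pos]
  refine partGF_congr fun s _ => ?_
  refine and_congr_left fun h => ?_
  rw [excess_succ h]

/-- The generating function of partitions with excess at least `j` and no part `k` or
`k + 1`. -/
noncomputable def gapGF (k : ℕ) (j : ℤ) : PowerSeries ℤ :=
  partGF fun s => (j ≤ excess k s ∧ k ∉ s) ∧ k + 1 ∉ s

lemma gapGF_eq {k : ℕ} (hk : 0 < k) (j : ℤ) :
    gapGF k j = (1 + X ^ (2 * k + 1)) * tailGF k j - X ^ (k + 1) * tailGF k (j - 1)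
      - X ^ k * tailGF k (j + 1) := by
  rw [gapGF, partGF_notMem (c := k + 1) _ k.succ_pos, partGF_excess_notMem hk,
    partGF_congr (S' := fun s => j - 1 ≤ excess k s ∧ k ∉ s)
      (fun s _ => by
        simp only [excess_cons, lt_add_one, if_true, Multiset.mem_cons]
        constructor
        · rintro ⟨h1, h2⟩
          exact ⟨by omega, fun h => h2 (Or.inr h)⟩
        · rintro ⟨h1, h2⟩
          exact ⟨by omega, fun h => h.elim (by omega) h2⟩),
    partGF_excess_notMem hk, sub_add_cancel]
  ring

/-- Moving every part one step away from `k + 1 / 2`. -/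
def spread (k : ℕ) (s : Multiset ℕ) : Multiset ℕ := s.map fun c => if k < c then c + 1 else c - 1

/-- Moving every part one step towards `k + 1 / 2`. -/
def squeeze (k : ℕ) (s : Multiset ℕ) : Multiset ℕ := s.map fun c => if k < c then c - 1 else c + 1

lemma sum_spread (k : ℕ) {s : Multiset ℕ} (h0 : 0 ∉ s) :
    ((spread k s).sum : ℤ) = s.sum + excess k s := by
  induction s using Multiset.induction with
  | empty => simp [spread, excess]
  | cons a s ih =>
    rw [Multiset.mem_cons, not_or] at h0
    have := ih h0.2
    simp only [spread, Multiset.map_cons, Multiset.sum_cons, excess_cons] at this ⊢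
    split_ifs <;> omega

lemma excess_spread (k : ℕ) (s : Multiset ℕ) : excess k (spread k s) = excess k s := by
  simp only [excess, spread, Multiset.map_map]
  congr 1
  refine Multiset.map_congr rfl fun x _ => ?_
  simp only [Function.comp]
  split_ifs <;> first | rfl | omega

lemma squeeze_spread {k : ℕ} {s : Multiset ℕ} (h0 : 0 ∉ s) : squeeze k (spread k s) = s := by
  rw [squeeze, spread, Multiset.map_map]
  conv_rhs => rw [← Multiset.map_id s]
  refine Multiset.map_congr rfl fun x hx => ?_
  have : x ≠ 0 := fun h => h0 (h ▸ hx)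
  simp only [Function.comp, id]
  split_ifs <;> omega

lemma spread_squeeze {k : ℕ} {s : Multiset ℕ} (hk : k ∉ s) (hk' : k + 1 ∉ s) :
    spread k (squeeze k s) = s := by
  rw [squeeze, spread, Multiset.map_map]
  conv_rhs => rw [← Multiset.map_id s]
  refine Multiset.map_congr rfl fun x hx => ?_
  have : x ≠ k := fun h => hk (h ▸ hx)
  have : x ≠ k + 1 := fun h => hk' (h ▸ hx)
  simp only [Function.comp, id]
  split_ifs <;> omega

lemma partGF_spread {k : ℕ} (hk : 0 < k) (j : ℕ) :
    partGF (fun s => (excess k s = j ∧ k ∉ s) ∧ k + 1 ∉ s) =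
      X ^ j * partGF (fun s => excess k s = j ∧ 1 ∉ s) := by
  refine partGF_eq_X_pow_mul j (spread k) (squeeze k) ?_ ?_
  · rintro s h0 ⟨hj, h1⟩
    have hpos : ∀ x ∈ s, x ≠ 0 ∧ x ≠ 1 := fun x hx => ⟨fun h => h0 (h ▸ hx), fun h => h1 (h ▸ hx)⟩
    have key : ∀ y ∈ spread k s, y ≠ 0 ∧ y ≠ k ∧ y ≠ k + 1 := by
      intro y hy
      obtain ⟨x, hx, rfl⟩ := Multiset.mem_map.mp hy
      have := hpos x hx
      split_ifs <;> omega
    refine ⟨fun h => (key _ h).1 rfl, ⟨⟨?_, fun h => (key _ h).2.1 rfl⟩,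
      fun h => (key _ h).2.2 rfl⟩, ?_, squeeze_spread h0⟩
    · rw [excess_spread, hj]
    · have := sum_spread k h0
      omega
  · rintro s h0 ⟨⟨hj, h1⟩, h2⟩
    have hpos : ∀ x ∈ s, x ≠ 0 ∧ x ≠ k ∧ x ≠ k + 1 := fun x hx =>
      ⟨fun h => h0 (h ▸ hx), fun h => h1 (h ▸ hx), fun h => h2 (h ▸ hx)⟩
    have key : ∀ y ∈ squeeze k s, y ≠ 0 ∧ y ≠ 1 := by
      intro y hy
      obtain ⟨x, hx, rfl⟩ := Multiset.mem_map.mp hy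
      have := hpos x hx
      split_ifs <;> omega
    have hs := spread_squeeze h1 h2
    have h0' : 0 ∉ squeeze k s := fun h => (key _ h).1 rfl
    have he := excess_spread k (squeeze k s)
    have hsum := sum_spread k h0'
    rw [hs] at he hsum
    exact ⟨h0', ⟨by omega, fun h => (key _ h).2 rfl⟩, by omega, hs⟩

lemma gapGF_sub_gapGF {k : ℕ} (hk : 0 < k) (j : ℕ) :
    gapGF k j - gapGF k (j + 1) =
      X ^ j * (tailGF k j - tailGF k (j + 1))
        - X ^ (j + 1) * (tailGF k (j + 1) - tailGF k (j + 1 + 1)) := by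
  have h1 : gapGF k j = partGF (fun s => (excess k s = j ∧ k ∉ s) ∧ k + 1 ∉ s)
      + gapGF k (j + 1) := by
    rw [gapGF, partGF_split _ (fun s => excess k s = j), gapGF]
    congr 1
    · exact partGF_congr fun s _ => by
        constructor
        · rintro ⟨⟨⟨_, h2⟩, h3⟩, h4⟩
          exact ⟨⟨h4, h2⟩, h3⟩
        · rintro ⟨⟨h4, h2⟩, h3⟩
          exact ⟨⟨⟨h4.ge, h2⟩, h3⟩, h4⟩
    · exact partGF_congr fun s _ => by
        constructor
        · rintro ⟨⟨⟨h1, h2⟩, h3⟩, h4⟩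
          exact ⟨⟨by omega, h2⟩, h3⟩
        · rintro ⟨⟨h4, h2⟩, h3⟩
          exact ⟨⟨⟨by omega, h2⟩, h3⟩, by omega⟩
  rw [h1, partGF_spread hk, partGF_notMem _ one_pos, partGF_excess_eq,
    partGF_congr (S' := fun s => excess k s = (j : ℤ) + 1)
      (fun s _ => by
        rw [excess_cons, if_neg (by omega)]
        omega), partGF_excess_eq]
  ring

lemma gapGF_eq_X_pow_mul {k : ℕ} (hk : 0 < k) (j : ℕ) :
    gapGF k j = X ^ j * (tailGF k j - tailGF k (j + 1)) := by
  have hconst : ∀ m : ℕ, gapGF k j - X ^ j * (tailGF k j - tailGF k (j + 1)) =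
      gapGF k ((j + m : ℕ) : ℤ)
        - X ^ (j + m) * (tailGF k ((j + m : ℕ) : ℤ) - tailGF k ((j + m : ℕ) + 1)) := by
    intro m
    induction m with
    | zero => simp
    | succ m ih =>
      rw [ih]
      have := gapGF_sub_gapGF hk (j + m)
      rw [← add_assoc, Nat.cast_succ (j + m)]
      linear_combination this
  rw [← sub_eq_zero]
  ext n
  rw [hconst (n + 2), gapGF_eq hk]
  simp only [map_sub, add_mul, one_mul, map_add, mul_sub, coeff_X_pow_mul']
  have hz : ∀ m ≤ n, ∀ i : ℤ, (n : ℤ) < i → coeff m (tailGF k i) = 0 :=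
    fun m hm i hi => coeff_tailGF_eq_zero k (by omega)
  rw [hz n le_rfl _ (by push_cast; omega), hz _ (Nat.sub_le _ _) _ (by push_cast; omega),
    hz _ (Nat.sub_le _ _) _ (by push_cast; omega), hz _ (Nat.sub_le _ _) _ (by push_cast; omega),
    hz _ (Nat.sub_le _ _) _ (by push_cast; omega), hz _ (Nat.sub_le _ _) _ (by push_cast; omega)]
  simp

lemma X_pow_mul_tailGF_pred (k : ℕ) :
    X ^ (k + 1) * tailGF k (k - 1) = (1 + X ^ (2 * k + 1) - X ^ k) * tailGF k k := by
  rcases Nat.eq_zero_or_pos k with rfl | hk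
  · have : tailGF 0 ((0 : ℕ) - 1) = tailGF 0 ((0 : ℕ) : ℤ) := by
      refine partGF_congr fun s hs => ?_
      rw [excess_zero hs]
      omega
    rw [this]
    ring
  · have h := gapGF_eq_X_pow_mul hk k
    rw [gapGF_eq hk] at h
    linear_combination -h

lemma one_sub_X_pow_ne_zero {m : ℕ} (hm : 0 < m) : (1 - X ^ m : PowerSeries ℤ) ≠ 0 := by
  intro h
  have := congrArg (coeff 0) h
  simp [hm.ne'] at this

lemma tailGF_self_succ (k : ℕ) :
    tailGF (k + 1) ((k + 1 : ℕ) : ℤ) = X ^ (2 * k + 2) * tailGF k k := by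
  have h1 := X_pow_mul_tailGF_pred k
  have h2 := X_pow_mul_tailGF_pred (k + 1)
  have h3 := tailGF_succ k k
  rw [Nat.cast_succ, add_sub_cancel_right] at h2
  rw [Nat.cast_succ]
  refine mul_left_cancel₀ (one_sub_X_pow_ne_zero (m := k + 1) k.succ_pos) ?_
  linear_combination -X ^ (k + 2) * h3 - h2 - X ^ (k + 2) * h1

lemma tailGF_self (k : ℕ) : tailGF k k = X ^ (k * (k + 1)) * partGF fun _ => True := by
  induction k with
  | zero =>
    simp only [zero_mul, pow_zero, one_mul]
    refine partGF_congr fun s hs => ?_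
    rw [excess_zero hs]
    simp
  | succ k ih =>
    rw [tailGF_self_succ, ih]
    ring

/-- For positive `k` this is the generating function of `M k`. -/
noncomputable def mexGF (k : ℕ) : PowerSeries ℤ :=
  X ^ (k.choose 2) * (tailGF k k - X ^ k * tailGF k (k + 1))

lemma mexGF_zero : mexGF 0 = 1 := by
  have h : mexGF 0 = partGF (fun s => excess 0 s = 0) := by
    simp [mexGF, partGF_excess_eq]
  rw [h]
  ext n
  rw [coeff_partGF, coeff_one]
  split_ifs with hn
  · subst hn
    have : ∀ p : Nat.Partition 0, excess 0 p.parts = 0 := fun p => by simp [excess]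
    rw [Nat.card_congr (Equiv.subtypeUnivEquiv this)]
    simp
  · have : IsEmpty {p : Nat.Partition n // excess 0 p.parts = 0} := ⟨fun p => by
      have h1 := p.2
      rw [excess_zero p.1.zero_notMem_parts, Nat.cast_eq_zero, Multiset.card_eq_zero] at h1
      have h2 := p.1.parts_sum
      rw [h1] at h2
      exact hn h2.symm⟩
    simp

lemma mexGF_add_mexGF_succ (k : ℕ) :
    mexGF k + mexGF (k + 1) =
      X ^ (k.choose 2 + k * (k + 1)) * (1 - X ^ (2 * k + 1)) * partGF fun _ => True := by
  have h := tailGF_succ k (k + 1)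
  have hc : (k + 1).choose 2 = k.choose 2 + k := by
    rw [Nat.choose_succ_succ' k 1, Nat.choose_one_right, add_comm]
  rw [add_sub_cancel_right] at h
  rw [mexGF, mexGF, Nat.cast_succ, ← h, hc, pow_add _ _ (k * (k + 1)), mul_assoc, mul_assoc,
    mul_left_comm (X ^ (k * (k + 1))), ← tailGF_self]
  ring

lemma neg_one_pow_mul_mexGF (k : ℕ) :
    (-1) ^ k * mexGF k = 1 - ∑ i ∈ Finset.range k,
      (-1) ^ i * (X ^ (i.choose 2 + i * (i + 1)) * (1 - X ^ (2 * i + 1)) *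
        partGF fun _ => True) := by
  induction k with
  | zero => simp [mexGF_zero]
  | succ k ih =>
    rw [Finset.sum_range_succ, ← mexGF_add_mexGF_succ]
    linear_combination ih

lemma mk_M_eq_mexGF {k : ℕ} (hk : 1 ≤ k) : PowerSeries.mk (fun n => (M k n : ℤ)) = mexGF k := by
  have hM : PowerSeries.mk (fun n => (M k n : ℤ)) = partGF (fun s =>
      (∀ i, 0 < i → i < k → i ∈ s) ∧ k ∉ s ∧
      (s.filter fun x => x < k).card < (s.filter fun x => k < x).card) := rfl
  have hexc : excess k (Finset.Ico 1 k).val = 1 - k := by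
    rw [excess, Multiset.map_congr rfl (g := fun _ => (-1 : ℤ))]
    · simp [Nat.cast_sub hk]
    · intro x hx
      rw [Finset.mem_val, Finset.mem_Ico] at hx
      rw [if_neg (by omega)]
  have hsum : (Finset.Ico 1 k).val.sum = k.choose 2 := by
    have h := Finset.sum_eq_sum_Ico_succ_bot (show 0 < k from hk) (fun i => i)
    rw [zero_add, zero_add] at h
    rw [Finset.sum_val, Nat.choose_two_right, ← Finset.sum_range_id, Finset.range_eq_Ico, h]
    rfl
  have hcond : ∀ s : Multiset ℕ, k ∉ s → ((s.filter fun x => x < k).card <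
      (s.filter fun x => k < x).card ↔ 1 ≤ excess k s) := by
    intro s hs
    have : (s.filter fun x => x ≤ k) = s.filter fun x => x < k :=
      Multiset.filter_congr fun x hx => by
        have : x ≠ k := fun h => hs (h ▸ hx)
        omega
    rw [excess_eq_card_sub_card, this]
    omega
  rw [hM, mexGF, ← partGF_excess_notMem hk]
  refine partGF_eq_X_pow_mul _ (fun s => s + (Finset.Ico 1 k).val)
    (fun s => s - (Finset.Ico 1 k).val) ?_ ?_
  · rintro s h0 ⟨h1, h2⟩
    have hk' : k ∉ s + (Finset.Ico 1 k).val := by simp [h2]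
    refine ⟨by simp [h0], ⟨fun i hi hik => ?_, hk', ?_⟩, ?_, add_tsub_cancel_right _ _⟩
    · rw [Multiset.mem_add, Finset.mem_val, Finset.mem_Ico]
      exact Or.inr ⟨hi, hik⟩
    · rw [hcond _ hk', excess_add, hexc]
      omega
    · rw [Multiset.sum_add, hsum]
  · rintro s h0 ⟨h1, h2, h3⟩
    have hle : (Finset.Ico 1 k).val ≤ s := by
      rw [Multiset.le_iff_subset (Finset.Ico 1 k).nodup]
      intro x hx
      rw [Finset.mem_val, Finset.mem_Ico] at hx
      exact h1 x hx.1 hx.2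
    have hs := tsub_add_cancel_of_le hle
    have hsub := Multiset.sub_le_self s (Finset.Ico 1 k).val
    refine ⟨fun h => h0 (Multiset.mem_of_le hsub h),
      ⟨?_, fun h => h2 (Multiset.mem_of_le hsub h)⟩, ?_, hs⟩
    · rw [hcond _ h2, ← hs, excess_add, hexc] at h3
      omega
    · rw [← hsum, ← Multiset.sum_add, hs]

/-- The generating function of partitions into odd parts less than `2 * n`. -/
noncomputable def oddGF (n : ℕ) : PowerSeries ℤ := partGF fun s => ∀ c ∈ s, Odd c ∧ c < 2 * n

/-- The generating function of partitions into even parts at most `2 * n`. -/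
noncomputable def evenGF (n : ℕ) : PowerSeries ℤ := partGF fun s => ∀ c ∈ s, Even c ∧ c ≤ 2 * n

lemma partGF_eq_one {S : Multiset ℕ → Prop} (h : ∀ s, 0 ∉ s → (S s ↔ s = 0)) : partGF S = 1 := by
  ext n
  rw [coeff_partGF, coeff_one]
  split_ifs with hn
  · subst hn
    have : ∀ p : Nat.Partition 0, S p.parts := fun p =>
      (h _ p.zero_notMem_parts).mpr (by simp)
    rw [Nat.card_congr (Equiv.subtypeUnivEquiv this)]
    simp
  · have : IsEmpty {p : Nat.Partition n // S p.parts} := ⟨fun p => by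
      have h1 := p.1.parts_sum
      rw [(h _ p.1.zero_notMem_parts).mp p.2] at h1
      exact hn h1.symm⟩
    simp

lemma oddGF_zero : oddGF 0 = 1 := by
  refine partGF_eq_one fun s _ => ⟨fun h => ?_, by rintro rfl; simp⟩
  refine Multiset.eq_zero_of_forall_notMem fun c hc => ?_
  have := (h c hc).2
  omega

lemma evenGF_zero : evenGF 0 = 1 := by
  refine partGF_eq_one fun s h0 => ⟨fun h => ?_, by rintro rfl; simp⟩
  refine Multiset.eq_zero_of_forall_notMem fun c hc => ?_
  have h1 := (h c hc).2
  exact h0 ((show c = 0 by omega) ▸ hc)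

/-- Forbidding the part `c` when parts are chosen freely from a set containing `c`. -/
lemma partGF_forall_mem {p q : ℕ → Prop} {c : ℕ} (hc : 0 < c) (hpc : p c)
    (hq : ∀ x, 0 < x → (q x ↔ p x ∧ x ≠ c)) :
    partGF (fun s => ∀ x ∈ s, p x) * (1 - X ^ c) = partGF (fun s => ∀ x ∈ s, q x) := by
  have h := partGF_notMem (fun s => ∀ x ∈ s, p x) hc
  rw [partGF_congr (S := fun s => ∀ x ∈ c ::ₘ s, p x) (S' := fun s => ∀ x ∈ s, p x)
    (fun s _ => by simp [hpc])] at h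
  rw [partGF_congr (S := fun s => ∀ x ∈ s, q x) (S' := fun s => (∀ x ∈ s, p x) ∧ c ∉ s), h]
  · ring
  · intro s h0
    have hpos : ∀ x ∈ s, 0 < x := fun x hx => Nat.pos_of_ne_zero fun h => h0 (h ▸ hx)
    constructor
    · exact fun h => ⟨fun x hx => ((hq x (hpos x hx)).mp (h x hx)).1,
        fun hcs => ((hq c hc).mp (h c hcs)).2 rfl⟩
    · exact fun h x hx => (hq x (hpos x hx)).mpr ⟨h.1 x hx, fun hxc => h.2 (hxc ▸ hx)⟩

lemma oddGF_succ (n : ℕ) : oddGF (n + 1) * (1 - X ^ (2 * n + 1)) = oddGF n := by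
  refine partGF_forall_mem (by omega) ⟨by simp, by omega⟩ fun x _ => ?_
  constructor
  · rintro ⟨h1, h2⟩
    exact ⟨⟨h1, by omega⟩, by omega⟩
  · rintro ⟨⟨⟨m, rfl⟩, h2⟩, h3⟩
    exact ⟨by simp, by omega⟩

lemma evenGF_succ (n : ℕ) : evenGF (n + 1) * (1 - X ^ (2 * n + 2)) = evenGF n := by
  refine partGF_forall_mem (by omega) ⟨⟨n + 1, by ring⟩, by omega⟩ fun x _ => ?_
  constructor
  · rintro ⟨h1, h2⟩
    exact ⟨⟨h1, by omega⟩, by omega⟩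
  · rintro ⟨⟨⟨m, rfl⟩, h2⟩, h3⟩
    exact ⟨by simp, by omega⟩

/-- The inverse of `oddGF n`. -/
noncomputable def oddProd (n : ℕ) : PowerSeries ℤ := ∏ i ∈ Finset.range n, (1 - X ^ (2 * i + 1))

lemma oddProd_succ (n : ℕ) : oddProd (n + 1) = oddProd n * (1 - X ^ (2 * n + 1)) :=
  Finset.prod_range_succ _ _

lemma oddGF_mul_oddProd (n : ℕ) : oddGF n * oddProd n = 1 := by
  induction n with
  | zero => simp [oddGF_zero, oddProd]
  | succ n ih =>
    rw [oddProd_succ]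
    linear_combination oddProd n * oddGF_succ n + ih

lemma T_succ (n : ℕ) : T (n + 1) = T n + (n + 1) := by
  rw [T, T, ← Nat.add_mul_div_left _ _ two_pos]
  congr 1
  ring

lemma T_two_mul (n : ℕ) : T (2 * n) = n * (2 * n + 1) := by
  rw [T, mul_assoc, Nat.mul_div_cancel_left _ two_pos]

lemma le_T (n : ℕ) : n ≤ T n := by
  induction n with
  | zero => simp
  | succ n ih => rw [T_succ]; omega

lemma T_strictMono : StrictMono T := strictMono_nat_of_lt_succ fun n => by
  rw [T_succ]; omega

/-- The generating function of the first `n` triangular numbers. -/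
noncomputable def triangularPoly (n : ℕ) : PowerSeries ℤ := ∑ s ∈ Finset.range n, X ^ T s

/-- Shanks' finite form of Gauss's identity for triangular numbers. -/
lemma sum_eq_triangularPoly_mul (n : ℕ) :
    ∑ s ∈ Finset.range n, oddGF n * evenGF s * oddProd s * X ^ (s * (2 * n + 1)) =
      triangularPoly (2 * n) * evenGF n := by
  induction n with
  | zero => simp [triangularPoly]
  | succ n ih =>
    have tele : ∀ m : ℕ, ∑ s ∈ Finset.range m, oddGF n * evenGF s * oddProd s *
        X ^ (s * (2 * n + 1)) * ((1 - X ^ (2 * n + 2)) * X ^ (2 * s) - (1 - X ^ (2 * n + 1))) =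
        oddGF n * evenGF m * oddProd m * X ^ (m * (2 * n + 1)) * (1 - X ^ (2 * m)) := by
      intro m
      induction m with
      | zero => simp
      | succ m ihm =>
        rw [Finset.sum_range_succ, ihm, oddProd_succ, ← evenGF_succ m]
        ring
    have hpoly : triangularPoly (2 * (n + 1)) = triangularPoly (2 * n) +
        X ^ (n * (2 * n + 1)) * (1 + X ^ (2 * n + 1)) := by
      rw [triangularPoly, triangularPoly, mul_add, mul_one, Finset.sum_range_succ,
        Finset.sum_range_succ, T_succ, T_two_mul]
      ring
    refine mul_right_cancel₀ (one_sub_X_pow_ne_zero (m := 2 * n + 2) (by omega)) ?_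
    refine mul_right_cancel₀ (one_sub_X_pow_ne_zero (m := 2 * n + 1) (by omega)) ?_
    rw [mul_assoc (triangularPoly _), evenGF_succ, hpoly, add_mul, ← ih]
    have hlhs : (∑ s ∈ Finset.range (n + 1), oddGF (n + 1) * evenGF s * oddProd s *
        X ^ (s * (2 * (n + 1) + 1))) * (1 - X ^ (2 * n + 2)) * (1 - X ^ (2 * n + 1)) =
        ∑ s ∈ Finset.range (n + 1), oddGF n * evenGF s * oddProd s *
          X ^ (s * (2 * n + 1)) * ((1 - X ^ (2 * n + 2)) * X ^ (2 * s)) := by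
      rw [Finset.sum_mul, Finset.sum_mul]
      refine Finset.sum_congr rfl fun s _ => ?_
      rw [← oddGF_succ n]
      ring
    have ht := tele n
    simp only [mul_sub _ (_ * X ^ _), Finset.sum_sub_distrib, ← Finset.sum_mul] at ht
    rw [hlhs, Finset.sum_range_succ]
    have hu : oddGF n * evenGF n * oddProd n = evenGF n := by
      rw [mul_right_comm, oddGF_mul_oddProd, one_mul]
    rw [hu] at ht ⊢
    linear_combination ht

/-- The generating function of partitions into even parts. -/
noncomputable def evenPartsGF : PowerSeries ℤ := partGF fun s => ∀ c ∈ s, Even c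

/-- The generating function of partitions into distinct parts. -/
noncomputable def distinctGF : PowerSeries ℤ := partGF fun s => s.Nodup

lemma coeff_partGF_congr {S S' : Multiset ℕ → Prop} {n : ℕ}
    (h : ∀ p : Nat.Partition n, S p.parts ↔ S' p.parts) :
    coeff n (partGF S) = coeff n (partGF S') := by
  rw [coeff_partGF, coeff_partGF]
  congr 1
  exact Nat.card_congr (Equiv.subtypeEquivRight h)

lemma coeff_evenGF {m n : ℕ} (h : m ≤ 2 * n) : coeff m (evenGF n) = coeff m evenPartsGF :=
  coeff_partGF_congr fun p => ⟨fun hp c hc => (hp c hc).1,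
    fun hp c hc => ⟨hp c hc, (p.le_of_mem_parts hc).trans h⟩⟩

lemma coeff_distinctGF (n : ℕ) : coeff n distinctGF = ((Nat.Partition.distincts n).card : ℤ) := by
  rw [distinctGF, coeff_partGF, Nat.card_eq_fintype_card, Fintype.card_subtype]
  rfl

lemma coeff_oddGF {m n : ℕ} (h : m < 2 * n) : coeff m (oddGF n) = coeff m distinctGF := by
  rw [coeff_distinctGF, ← Nat.Partition.card_odds_eq_card_distincts, oddGF, coeff_partGF_congr
    (S' := fun s => ∀ c ∈ s, ¬ Even c), coeff_partGF, Nat.card_eq_fintype_card,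
    Fintype.card_subtype]
  · rfl
  · exact fun p => ⟨fun hp c hc => Nat.not_even_iff_odd.mpr (hp c hc).1,
      fun hp c hc => ⟨Nat.not_even_iff_odd.mp (hp c hc), (p.le_of_mem_parts hc).trans_lt h⟩⟩

/-- Gauss's identity for triangular numbers. -/
lemma coeff_triangularPoly_mul_evenPartsGF {m n : ℕ} (h : m < 2 * n) :
    coeff m (triangularPoly (2 * n) * evenPartsGF) = coeff m distinctGF := by
  have h1 : coeff m (triangularPoly (2 * n) * evenPartsGF) =
      coeff m (triangularPoly (2 * n) * evenGF n) := by
    rw [coeff_mul, coeff_mul]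
    refine Finset.sum_congr rfl fun x hx => ?_
    have := Finset.HasAntidiagonal.mem_antidiagonal.mp hx
    rw [coeff_evenGF (by omega)]
  obtain ⟨n, rfl⟩ : ∃ k, n = k + 1 := ⟨n - 1, by omega⟩
  rw [h1, ← sum_eq_triangularPoly_mul, Finset.sum_range_succ', map_add, map_sum,
    Finset.sum_eq_zero, evenGF_zero, zero_add, ← coeff_oddGF h]
  · simp [oddProd]
  · intro s _
    rw [coeff_mul_X_pow', if_neg]
    nlinarith

lemma evenPartsGF_eq_expand : evenPartsGF = expand 2 two_ne_zero (partGF fun _ => True) := by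
  ext n
  rw [coeff_expand, evenPartsGF, coeff_partGF]
  have half : ∀ s : Multiset ℕ, (∀ c ∈ s, Even c) →
      (s.map fun c => c / 2).map (fun c => 2 * c) = s := by
    intro s hs
    rw [Multiset.map_map]
    conv_rhs => rw [← Multiset.map_id s]
    refine Multiset.map_congr rfl fun x hx => ?_
    obtain ⟨m, rfl⟩ := hs x hx
    simp only [Function.comp, id]
    omega
  have double : ∀ s : Multiset ℕ, (s.map fun c => 2 * c).map (fun c => c / 2) = s := by
    intro s
    rw [Multiset.map_map]
    conv_rhs => rw [← Multiset.map_id s]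
    refine Multiset.map_congr rfl fun x _ => ?_
    simp
  have hsum : ∀ s : Multiset ℕ, (s.map fun c => 2 * c).sum = 2 * s.sum := fun s => by
    rw [Multiset.sum_map_mul_left, Multiset.map_id']
  split_ifs with h
  · obtain ⟨m, rfl⟩ := h
    rw [Nat.mul_div_cancel_left _ two_pos, coeff_partGF]
    congr 1
    refine Nat.card_congr
      { toFun := fun p => ⟨⟨p.1.parts.map fun c => c / 2, fun {i} hi => ?_, ?_⟩, trivial⟩
        invFun := fun p => ⟨⟨p.1.parts.map fun c => 2 * c, fun {i} hi => ?_, ?_⟩, ?_⟩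
        left_inv := fun p => Subtype.ext (Nat.Partition.ext (half _ p.2))
        right_inv := fun p => Subtype.ext (Nat.Partition.ext (double _)) }
    · obtain ⟨x, hx, rfl⟩ := Multiset.mem_map.mp hi
      have h1 := p.1.parts_pos hx
      obtain ⟨y, rfl⟩ := p.2 x hx
      omega
    · have h1 := hsum (p.1.parts.map fun c => c / 2)
      rw [half _ p.2, p.1.parts_sum] at h1
      omega
    · obtain ⟨x, hx, rfl⟩ := Multiset.mem_map.mp hi
      have h1 := p.1.parts_pos hx
      omega
    · rw [hsum, p.1.parts_sum]
    · intro c hc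
      obtain ⟨x, hx, rfl⟩ := Multiset.mem_map.mp hc
      simp
  · have : IsEmpty {p : Nat.Partition n // ∀ c ∈ p.parts, Even c} := ⟨fun p => h <| by
      rw [← p.1.parts_sum]
      exact Multiset.dvd_sum fun x hx => (p.2 x hx).two_dvd⟩
    simp

lemma two_mul_choose_two (i : ℕ) : 2 * i.choose 2 + i = i * i := by
  induction i with
  | zero => simp
  | succ i ih =>
    rw [Nat.choose_succ_succ' i 1, Nat.choose_one_right]
    linarith

lemma two_mul_T (n : ℕ) : 2 * T n = n * (n + 1) :=
  Nat.mul_div_cancel' (Nat.even_mul_succ_self n).two_dvd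

lemma G_two_mul (i : ℕ) : G (2 * i) = i.choose 2 + i * (i + 1) := by
  have h1 := two_mul_T i
  have h2 := two_mul_choose_two i
  rw [G, T_two_mul, Nat.mul_div_cancel_left _ two_pos]
  refine Nat.sub_eq_of_eq_add ?_
  linarith

lemma G_two_mul_add_one (i : ℕ) : G (2 * i + 1) = i.choose 2 + i * (i + 1) + (2 * i + 1) := by
  have h : T i ≤ T (2 * i) := T_strictMono.monotone (by omega)
  have h0 : (2 * i + 1) / 2 = i := by omega
  have h1 := G_two_mul i
  rw [G, Nat.mul_div_cancel_left _ two_pos] at h1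
  rw [G, h0, T_succ, ← h1]
  omega

lemma neg_one_pow_T_two_mul (i : ℕ) : (-1 : ℤ) ^ T (2 * i) = (-1) ^ i := by
  rw [T_two_mul, mul_comm, pow_mul]
  congr 1
  exact Odd.neg_one_pow (by simp)

lemma neg_one_pow_T_two_mul_add_one (i : ℕ) : (-1 : ℤ) ^ T (2 * i + 1) = -(-1) ^ i := by
  rw [T_succ, pow_add, neg_one_pow_T_two_mul, Odd.neg_one_pow (n := 2 * i + 1) ⟨i, rfl⟩, mul_neg_one]

lemma coeff_X_pow_two_mul_mul_distinctGF (n g : ℕ) :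
    coeff n (X ^ (2 * g) * distinctGF) = Q ((n : ℤ) - 2 * (g : ℤ)) := by
  rw [coeff_X_pow_mul', Q, coeff_distinctGF]
  by_cases h : 2 * g ≤ n
  · have : ((n : ℤ) - 2 * (g : ℤ)).toNat = n - 2 * g := by omega
    rw [if_pos h, if_pos (by omega), this]
  · rw [if_neg h, if_neg (by omega)]

lemma coeff_triangularPoly {m n : ℕ} (h : m < n) : coeff m (triangularPoly n) = chi m := by
  rw [triangularPoly, map_sum, chi]
  simp only [coeff_X_pow]
  split_ifs with hm
  · obtain ⟨j, rfl⟩ := hm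
    rw [Finset.sum_eq_single j]
    · simp
    · exact fun i _ hij => if_neg fun h => hij (T_strictMono.injective h).symm
    · intro hj
      have := le_T j
      exact absurd (Finset.mem_range.mpr (by omega)) hj
  · exact Finset.sum_eq_zero fun i _ => if_neg fun h => hm ⟨i, h⟩

lemma coeff_mul_triangularPoly_mul_evenPartsGF {m n : ℕ} (h : m < 2 * n) (A : PowerSeries ℤ) :
    coeff m (A * (triangularPoly (2 * n) * evenPartsGF)) = coeff m (A * distinctGF) := by
  rw [coeff_mul, coeff_mul]
  refine Finset.sum_congr rfl fun x hx => ?_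
  have := Finset.HasAntidiagonal.mem_antidiagonal.mp hx
  rw [coeff_triangularPoly_mul_evenPartsGF (by omega)]

lemma sum_range_two_mul {α : Type*} [AddCommMonoid α] (f : ℕ → α) (k : ℕ) :
    ∑ j ∈ Finset.range (2 * k), f j = ∑ i ∈ Finset.range k, (f (2 * i) + f (2 * i + 1)) := by
  induction k with
  | zero => simp
  | succ k ih =>
    rw [mul_add, mul_one, Finset.sum_range_succ, Finset.sum_range_succ, ih,
      Finset.sum_range_succ _ k, add_assoc]

/-- The truncated pentagonal number series. -/
noncomputable def pentagonalPoly (k : ℕ) : PowerSeries ℤ :=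
  ∑ j ∈ Finset.range (2 * k), (-1) ^ T j * X ^ G j

lemma neg_one_pow_mul_mexGF_eq_pentagonalPoly (k : ℕ) :
    (-1) ^ k * mexGF k = 1 - pentagonalPoly k * partGF fun _ => True := by
  rw [neg_one_pow_mul_mexGF, pentagonalPoly, sum_range_two_mul, Finset.sum_mul]
  congr 1
  refine Finset.sum_congr rfl fun i _ => ?_
  have h1 := congrArg (Int.castRingHom (PowerSeries ℤ)) (neg_one_pow_T_two_mul i)
  have h2 := congrArg (Int.castRingHom (PowerSeries ℤ)) (neg_one_pow_T_two_mul_add_one i)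
  simp only [map_pow, map_neg, map_one] at h1 h2
  rw [h1, h2, G_two_mul, G_two_mul_add_one]
  ring

lemma expand_pentagonalPoly (k : ℕ) : expand 2 two_ne_zero (pentagonalPoly k) =
    ∑ j ∈ Finset.range (2 * k), (-1) ^ T j * X ^ (2 * G j) := by
  simp only [pentagonalPoly, map_sum, map_mul, map_pow, map_neg, map_one, expand_X, pow_mul]

lemma coeff_expand_pentagonalPoly_mul_distinctGF (n k : ℕ) :
    coeff n (expand 2 two_ne_zero (pentagonalPoly k) * distinctGF) =
      ∑ j ∈ Finset.range (2 * k), (-1 : ℤ) ^ T j * Q ((n : ℤ) - 2 * (G j : ℤ)) := by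
  rw [expand_pentagonalPoly, Finset.sum_mul, map_sum]
  refine Finset.sum_congr rfl fun j _ => ?_
  rw [← coeff_X_pow_two_mul_mul_distinctGF, mul_assoc, ← coeff_C_mul]
  simp

lemma coeff_triangularPoly_mul_expand_mexGF {k : ℕ} (hk : 1 ≤ k) (m n : ℕ) :
    coeff n (triangularPoly m * expand 2 two_ne_zero (mexGF k)) =
      ∑ j ∈ Finset.range m,
        if T j ≤ n ∧ n % 2 = T j % 2 then (M k ((n - T j) / 2) : ℤ) else 0 := by
  rw [triangularPoly, Finset.sum_mul, map_sum]
  refine Finset.sum_congr rfl fun j _ => ?_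
  rw [coeff_X_pow_mul', coeff_expand, ← mk_M_eq_mexGF hk, coeff_mk]
  split_ifs <;> first | rfl | omega

theorem stmt_12 (n k : ℕ) (hk : 1 ≤ k) :
    (-1 : ℤ) ^ (k - 1) *
        ((∑ j ∈ Finset.range (2 * k), (-1 : ℤ) ^ (T j) * Q ((n : ℤ) - 2 * (G j : ℤ))) - chi n)
      = ∑' j : ℕ, if T j ≤ n ∧ n % 2 = T j % 2 then (M k ((n - T j) / 2) : ℤ) else 0 := by
  have hn : n < 2 * (n + 1) := by omega
  rw [tsum_eq_sum (s := Finset.range (2 * (n + 1))), ← coeff_triangularPoly_mul_expand_mexGF hk,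
    ← coeff_expand_pentagonalPoly_mul_distinctGF, ← coeff_triangularPoly hn,
    ← coeff_mul_triangularPoly_mul_evenPartsGF hn, ← map_sub, evenPartsGF_eq_expand]
  · have h := congrArg (expand 2 two_ne_zero) (neg_one_pow_mul_mexGF_eq_pentagonalPoly k)
    simp only [map_mul, map_sub, map_pow, map_neg, map_one] at h
    rw [← coeff_C_mul]
    congr 1
    obtain ⟨k, rfl⟩ : ∃ l, k = l + 1 := ⟨k - 1, by omega⟩
    have hsq : ((-1) ^ k * (-1) ^ k : PowerSeries ℤ) = 1 := by
      rw [← mul_pow]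
      simp
    rw [pow_succ] at h
    simp only [add_tsub_cancel_right, map_pow, map_neg, map_one]
    linear_combination ((-1) ^ k * triangularPoly (2 * (n + 1))) * h +
      triangularPoly (2 * (n + 1)) * expand 2 two_ne_zero (mexGF (k + 1)) * hsq
  · intro j hj
    have h1 := le_T j
    rw [Finset.mem_range] at hj
    exact if_neg fun h => by omega
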